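/- Let G be an abelian group and X, Y independent finitely supported G-valued random variables. For integers p, q with |p|, |q| ≥ 1, H(pX + qY) − H(X + Y) ≤ (7⌊log₂|p|⌋ + 7⌊log₂|q|⌋ + 2)·(2H(X+Y) − H(X) − H(Y)). -/

import Mathlib

open scoped Classical BigOperators

/-- Probability of the event `X = a` under the probability mass function `μ`. -/
noncomputable def pr {Ω α : Type*} [Fintype Ω] (μ : Ω → ℝ) (X : Ω → α) (a : α) : ℝ :=
  ∑ ω : Ω, if X ω = a then μ ω else 0

/-- Shannon entropy of the discrete random variable `X` on the finite probability
space with mass function `μ`. -/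
noncomputable def entropy {Ω α : Type*} [Fintype Ω] (μ : Ω → ℝ) (X : Ω → α) : ℝ :=
  ∑ a ∈ Finset.univ.image X, Real.negMulLog (pr μ X a)

lemma pr_nonneg' {Ω α : Type*} [Fintype Ω] {μ : Ω → ℝ} (h : ∀ ω, 0 ≤ μ ω) (X : Ω → α) (a : α) :
    0 ≤ pr μ X a :=
  Finset.sum_nonneg fun ω _ => by split_ifs <;> simp [h]

lemma le_pr {Ω α : Type*} [Fintype Ω] {μ : Ω → ℝ} (h : ∀ ω, 0 ≤ μ ω) (X : Ω → α) (ω : Ω) :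
    μ ω ≤ pr μ X (X ω) := by
  have := Finset.single_le_sum (f := fun ω' => if X ω' = X ω then μ ω' else 0)
    (fun ω' _ => by split_ifs <;> simp [h]) (Finset.mem_univ ω)
  simpa [pr] using this

/-- Grouping a sum over the sample space by the values of `X`. -/
lemma sum_group {Ω α : Type*} [Fintype Ω] (μ : Ω → ℝ) (X : Ω → α) (F : α → ℝ)
    (s : Finset α) (hs : ∀ ω, X ω ∈ s) :
    ∑ ω, μ ω * F (X ω) = ∑ a ∈ s, pr μ X a * F a := by
  simp only [pr, Finset.sum_mul]
  rw [Finset.sum_comm]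
  refine Finset.sum_congr rfl fun ω _ => ?_
  rw [Finset.sum_eq_single (X ω)]
  · simp
  · intro b _ hb
    simp [hb.symm]
  · intro h
    exact absurd (hs ω) h

lemma entropy_eq {Ω α : Type*} [Fintype Ω] (μ : Ω → ℝ) (X : Ω → α) :
    entropy μ X = - ∑ ω, μ ω * Real.log (pr μ X (X ω)) := by
  rw [sum_group μ X (fun a => Real.log (pr μ X a)) (Finset.univ.image X) (by simp), entropy,
    ← Finset.sum_neg_distrib]
  refine Finset.sum_congr rfl fun a _ => ?_
  simp [Real.negMulLog]

lemma entropy_congr_rel {Ω α β : Type*} [Fintype Ω] (μ : Ω → ℝ) (X : Ω → α) (Y : Ω → β)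
    (h : ∀ ω ω', X ω = X ω' ↔ Y ω = Y ω') : entropy μ X = entropy μ Y := by
  rw [entropy_eq, entropy_eq]
  simp only [pr, h]

lemma sum_pr_pair {Ω α β : Type*} [Fintype Ω] (μ : Ω → ℝ) (A : Ω → α) (C : Ω → β) (c : β) :
    ∑ a ∈ Finset.univ.image A, pr μ (fun ω => (A ω, C ω)) (a, c) = pr μ C c := by
  simp only [pr]
  rw [Finset.sum_comm]
  refine Finset.sum_congr rfl fun ω _ => ?_
  rw [Finset.sum_eq_single (A ω)]
  · simp
  · intro b _ hb
    simp [hb.symm]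
  · intro h
    simp at h

/-- Submodularity of entropy. -/
lemma entropy_submod {Ω α β γ : Type*} [Fintype Ω] (μ : Ω → ℝ) (h0 : ∀ ω, 0 ≤ μ ω)
    (h1 : ∑ ω, μ ω = 1) (A : Ω → α) (B : Ω → β) (C : Ω → γ) :
    entropy μ (fun ω => (A ω, B ω, C ω)) + entropy μ C
      ≤ entropy μ (fun ω => (A ω, C ω)) + entropy μ (fun ω => (B ω, C ω)) := by
  set T := fun ω => (A ω, B ω, C ω) with hT
  set AC := fun ω => (A ω, C ω) with hAC
  set BC := fun ω => (B ω, C ω) with hBC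
  let F : α × β × γ → ℝ := fun t =>
    pr μ AC (t.1, t.2.2) * pr μ BC (t.2.1, t.2.2) / (pr μ T t * pr μ C t.2.2)
  have key : ∀ ω, μ ω * Real.log (pr μ AC (AC ω)) + μ ω * Real.log (pr μ BC (BC ω))
      - μ ω * Real.log (pr μ T (T ω)) - μ ω * Real.log (pr μ C (C ω))
      ≤ μ ω * F (T ω) - μ ω := by
    intro ω
    rcases (h0 ω).eq_or_lt with h | h
    · simp [← h]
    have p1 := h.trans_le (le_pr h0 AC ω)
    have p2 := h.trans_le (le_pr h0 BC ω)
    have p3 := h.trans_le (le_pr h0 T ω)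
    have p4 := h.trans_le (le_pr h0 C ω)
    have hF : F (T ω) = pr μ AC (AC ω) * pr μ BC (BC ω) / (pr μ T (T ω) * pr μ C (C ω)) := rfl
    have hlog := Real.log_le_sub_one_of_pos
      (show 0 < F (T ω) by rw [hF]; positivity)
    have : Real.log (F (T ω)) = Real.log (pr μ AC (AC ω)) + Real.log (pr μ BC (BC ω))
        - Real.log (pr μ T (T ω)) - Real.log (pr μ C (C ω)) := by
      rw [hF, Real.log_div (by positivity) (by positivity), Real.log_mul p1.ne' p2.ne',
        Real.log_mul p3.ne' p4.ne']
      ring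
    rw [this] at hlog
    nlinarith [mul_le_mul_of_nonneg_left hlog h.le]
  have hsum : ∑ ω, μ ω * F (T ω) ≤ 1 := by
    rw [sum_group μ T F
      (Finset.univ.image A ×ˢ Finset.univ.image B ×ˢ Finset.univ.image C) (by simp [hT])]
    have hle : ∀ t : α × β × γ, pr μ T t * F t ≤
        pr μ AC (t.1, t.2.2) * pr μ BC (t.2.1, t.2.2) / pr μ C t.2.2 := by
      intro t
      have n1 := pr_nonneg' h0 AC (t.1, t.2.2)
      have n2 := pr_nonneg' h0 BC (t.2.1, t.2.2)
      have n3 := pr_nonneg' h0 C t.2.2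
      rcases (pr_nonneg' h0 T t).eq_or_lt with h | h
      · rw [← h, zero_mul]
        positivity
      · apply le_of_eq
        simp only [F]
        field_simp
    refine (Finset.sum_le_sum fun t _ => hle t).trans ?_
    rw [Finset.sum_product]
    simp only [Finset.sum_product_right]
    rw [Finset.sum_comm]
    have : ∀ c, ∑ a ∈ Finset.univ.image A, ∑ b ∈ Finset.univ.image B,
        pr μ AC (a, c) * pr μ BC (b, c) / pr μ C c = pr μ C c * 1 := by
      intro c
      have e : ∀ a, ∑ b ∈ Finset.univ.image B, pr μ AC (a, c) * pr μ BC (b, c) / pr μ C c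
          = pr μ AC (a, c) * (pr μ C c / pr μ C c) := by
        intro a
        rw [← Finset.sum_div, ← Finset.mul_sum, sum_pr_pair, mul_div_assoc]
      simp only [e]
      rw [← Finset.sum_mul, sum_pr_pair]
      by_cases hc : pr μ C c = 0
      · simp [hc]
      · simp [hc]
    simp only [this]
    rw [← sum_group μ C (fun _ => (1 : ℝ)) _ (by simp)]
    simp [h1]
  have := Finset.sum_le_sum fun ω (_ : ω ∈ Finset.univ) => key ω
  simp only [Finset.sum_add_distrib, Finset.sum_sub_distrib, h1] at this
  simp only [entropy_eq]
  linarith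

lemma entropy_const {Ω α : Type*} [Fintype Ω] (μ : Ω → ℝ)
    (h1 : ∑ ω, μ ω = 1) (a : α) : entropy μ (fun _ => a) = 0 := by
  simp [entropy_eq, pr, h1]

lemma entropy_pair_le {Ω α β : Type*} [Fintype Ω] (μ : Ω → ℝ) (h0 : ∀ ω, 0 ≤ μ ω)
    (h1 : ∑ ω, μ ω = 1) (A : Ω → α) (B : Ω → β) :
    entropy μ (fun ω => (A ω, B ω)) ≤ entropy μ A + entropy μ B := by
  have := entropy_submod μ h0 h1 A B (fun _ => ())
  rw [entropy_const μ h1, entropy_congr_rel μ (fun ω => (A ω, B ω, ())) (fun ω => (A ω, B ω))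
    (by simp), entropy_congr_rel μ (fun ω => (A ω, ())) A (by simp),
    entropy_congr_rel μ (fun ω => (B ω, ())) B (by simp)] at this
  linarith

/-- Product mass function. -/
def prodMass {Ω Ω' : Type*} (μ : Ω → ℝ) (ν : Ω' → ℝ) : Ω × Ω' → ℝ := fun w => μ w.1 * ν w.2

lemma prodMass_sum {Ω Ω' : Type*} [Fintype Ω] [Fintype Ω'] {μ : Ω → ℝ} {ν : Ω' → ℝ}
    (h1 : ∑ ω, μ ω = 1) (h2 : ∑ ω, ν ω = 1) : ∑ w, prodMass μ ν w = 1 := by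
  simp only [prodMass, Fintype.sum_prod_type, ← Finset.mul_sum, h1, h2, mul_one]

lemma prodMass_nonneg {Ω Ω' : Type*} {μ : Ω → ℝ} {ν : Ω' → ℝ}
    (h1 : ∀ ω, 0 ≤ μ ω) (h2 : ∀ ω, 0 ≤ ν ω) (w) : 0 ≤ prodMass μ ν w :=
  mul_nonneg (h1 _) (h2 _)

lemma pr_prod {Ω Ω' α β : Type*} [Fintype Ω] [Fintype Ω'] (μ : Ω → ℝ) (ν : Ω' → ℝ)
    (X : Ω → α) (Y : Ω' → β) (a : α) (b : β) :
    pr (prodMass μ ν) (fun w => (X w.1, Y w.2)) (a, b) = pr μ X a * pr ν Y b := by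
  simp only [pr, prodMass, Fintype.sum_prod_type, Finset.sum_mul_sum]
  refine Finset.sum_congr rfl fun i _ => Finset.sum_congr rfl fun j _ => ?_
  by_cases h : X i = a <;> by_cases h' : Y j = b <;> simp [h, h']

/-- Additivity of entropy over independent pairs. -/
lemma entropy_prod {Ω Ω' α β : Type*} [Fintype Ω] [Fintype Ω'] (μ : Ω → ℝ) (ν : Ω' → ℝ)
    (h0 : ∀ ω, 0 ≤ μ ω) (h0' : ∀ ω, 0 ≤ ν ω)
    (h1 : ∑ ω, μ ω = 1) (h2 : ∑ ω, ν ω = 1) (X : Ω → α) (Y : Ω' → β) :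
    entropy (prodMass μ ν) (fun w => (X w.1, Y w.2)) = entropy μ X + entropy ν Y := by
  simp only [entropy_eq, pr_prod]
  have : ∀ w : Ω × Ω', prodMass μ ν w * Real.log (pr μ X (X w.1) * pr ν Y (Y w.2)) =
      μ w.1 * Real.log (pr μ X (X w.1)) * ν w.2 + μ w.1 * (ν w.2 * Real.log (pr ν Y (Y w.2))) := by
    rintro ⟨i, j⟩
    simp only [prodMass]
    rcases (h0 i).eq_or_lt with h | h
    · simp [← h]
    rcases (h0' j).eq_or_lt with h' | h'
    · simp [← h']
    rw [Real.log_mul (h.trans_le (le_pr h0 X i)).ne' (h'.trans_le (le_pr h0' Y j)).ne']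
    ring
  simp only [this, Finset.sum_add_distrib, Fintype.sum_prod_type, ← Finset.mul_sum,
    ← Finset.sum_mul, h1, h2]
  ring

/-- The law of a random variable, as an element of the group algebra. -/
noncomputable def law {Ω G : Type*} [Fintype Ω] (μ : Ω → ℝ) (X : Ω → G) :
    AddMonoidAlgebra ℝ G :=
  ∑ ω, AddMonoidAlgebra.single (X ω) (μ ω)

/-- Entropy of a law. -/
noncomputable def lawH {G : Type*} (ν : AddMonoidAlgebra ℝ G) : ℝ :=
  ∑ a ∈ ν.coeff.support, Real.negMulLog (ν.coeff a)

lemma law_coeff {Ω G : Type*} [Fintype Ω] (μ : Ω → ℝ) (X : Ω → G) (a : G) :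
    (law μ X).coeff a = pr μ X a := by
  simp [law, pr, Finsupp.single_apply]

lemma entropy_eq_lawH {Ω G : Type*} [Fintype Ω] (μ : Ω → ℝ) (X : Ω → G) :
    entropy μ X = lawH (law μ X) := by
  simp only [entropy, lawH, law_coeff]
  symm
  apply Finset.sum_subset
  · intro a ha
    rw [Finsupp.mem_support_iff, law_coeff] at ha
    by_contra hc
    apply ha
    simp only [Finset.mem_image, Finset.mem_univ, true_and, not_exists] at hc
    simp [pr, hc]
  · intro a _ ha
    rw [Finsupp.mem_support_iff, law_coeff, not_not] at ha
    simp [ha]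

lemma law_prod {Ω Ω' G : Type*} [Fintype Ω] [Fintype Ω'] [AddCommGroup G]
    (μ : Ω → ℝ) (ν : Ω' → ℝ) (X : Ω → G) (Y : Ω' → G) :
    law (prodMass μ ν) (fun w => X w.1 + Y w.2) = law μ X * law ν Y := by
  simp [law, Finset.sum_mul_sum, Fintype.sum_prod_type, AddMonoidAlgebra.single_mul_single,
    prodMass]

lemma law_zero {Ω G : Type*} [Fintype Ω] [AddCommGroup G] (μ : Ω → ℝ)
    (h1 : ∑ ω, μ ω = 1) : law μ (fun _ => (0 : G)) = 1 := by
  ext a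
  rw [law_coeff, AddMonoidAlgebra.one_def]
  simp [pr, Finsupp.single_apply]
  split_ifs <;> simp [h1]

lemma entropy_prod_add {Ω Ω' G : Type*} [Fintype Ω] [Fintype Ω'] [AddCommGroup G]
    (μ : Ω → ℝ) (ν : Ω' → ℝ) (X : Ω → G) (Y : Ω' → G) :
    entropy (prodMass μ ν) (fun w => X w.1 + Y w.2) = lawH (law μ X * law ν Y) := by
  rw [entropy_eq_lawH, law_prod]

lemma entropy_prod_add3 {Ω Ω' Ω'' G : Type*} [Fintype Ω] [Fintype Ω'] [Fintype Ω'']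
    [AddCommGroup G] (μ : Ω → ℝ) (ν : Ω' → ℝ) (ρ : Ω'' → ℝ)
    (X : Ω → G) (Y : Ω' → G) (Z : Ω'' → G) :
    entropy (prodMass μ (prodMass ν ρ)) (fun w => X w.1 + (Y w.2.1 + Z w.2.2))
      = lawH (law μ X * (law ν Y * law ρ Z)) := by
  rw [entropy_eq_lawH, law_prod μ (prodMass ν ρ) X (fun v => Y v.1 + Z v.2), law_prod]

/-- `ν` is the law of some random variable on a finite probability space. -/
def IsLaw {G : Type*} (ν : AddMonoidAlgebra ℝ G) : Prop :=
  ∃ (n : ℕ) (μ : Fin n → ℝ) (X : Fin n → G), (∀ ω, 0 ≤ μ ω) ∧ ∑ ω, μ ω = 1 ∧ ν = law μ X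

lemma law_equiv {Ω Ω' G : Type*} [Fintype Ω] [Fintype Ω'] (e : Ω' ≃ Ω) (μ : Ω → ℝ) (X : Ω → G) :
    law μ X = law (μ ∘ e) (X ∘ e) := by
  simp only [law, Function.comp]
  exact (Equiv.sum_comp e (fun ω => AddMonoidAlgebra.single (X ω) (μ ω))).symm

lemma isLaw_law {Ω G : Type*} [Fintype Ω] {μ : Ω → ℝ} (h0 : ∀ ω, 0 ≤ μ ω)
    (h1 : ∑ ω, μ ω = 1) (X : Ω → G) : IsLaw (law μ X) := by
  let e := (Fintype.equivFin Ω).symm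
  refine ⟨Fintype.card Ω, μ ∘ e, X ∘ e, fun ω => h0 _, ?_, law_equiv e μ X⟩
  rw [← h1]
  exact Equiv.sum_comp e μ

lemma IsLaw.mul {G : Type*} [AddCommGroup G] {a b : AddMonoidAlgebra ℝ G} (ha : IsLaw a)
    (hb : IsLaw b) : IsLaw (a * b) := by
  obtain ⟨n, μ, X, h0, h1, rfl⟩ := ha
  obtain ⟨m, ν, Y, h0', h1', rfl⟩ := hb
  rw [← law_prod]
  exact isLaw_law (prodMass_nonneg h0 h0') (prodMass_sum h1 h1') _

lemma isLaw_one {G : Type*} [AddCommGroup G] : IsLaw (1 : AddMonoidAlgebra ℝ G) := by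
  rw [← law_zero (G := G) (fun _ : Unit => (1 : ℝ)) (by simp)]
  exact isLaw_law (by simp) (by simp) _

/-- Key inequality: for independent `X, Z, W`,
`H((mα+γ)X + W) + H(Z) ≤ H(αX − Z) + H(γX + mZ + W)`. -/
lemma key_ineq {Ω Ω' G : Type*} [Fintype Ω] [Fintype Ω'] [AddCommGroup G]
    {μ : Ω → ℝ} (h0 : ∀ ω, 0 ≤ μ ω) (h1 : ∑ ω, μ ω = 1)
    {ν : Ω' → ℝ} (k0 : ∀ ω, 0 ≤ ν ω) (k1 : ∑ ω, ν ω = 1)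
    (X : Ω → G) (Z : Ω' → G) {w : AddMonoidAlgebra ℝ G} (hw : IsLaw w) (m α γ : ℤ) :
    lawH (law μ (fun ω => (m * α + γ) • X ω) * w) + lawH (law ν Z)
      ≤ lawH (law μ (fun ω => α • X ω) * law ν (fun ω => - Z ω))
        + lawH (law μ (fun ω => γ • X ω) * (law ν (fun ω => m • Z ω) * w)) := by
  obtain ⟨n, ρ, W, r0, r1, rfl⟩ := hw
  set π := prodMass μ (prodMass ν ρ) with hπ
  have p0 : ∀ ω, 0 ≤ π ω := prodMass_nonneg h0 (prodMass_nonneg k0 r0)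
  have p1 : ∑ ω, π ω = 1 := prodMass_sum h1 (prodMass_sum k1 r1)
  let C : Ω × Ω' × Fin n → G := fun t => (m * α + γ) • X t.1 + (0 + W t.2.2)
  let A : Ω × Ω' × Fin n → G × G := fun t => (X t.1, W t.2.2)
  let P : Ω × Ω' × Fin n → G := fun t => α • X t.1 + (- Z t.2.1 + 0)
  let Q : Ω × Ω' × Fin n → G := fun t => γ • X t.1 + (m • Z t.2.1 + W t.2.2)
  have hC : entropy π C = lawH (law μ (fun ω => (m * α + γ) • X ω) * law ρ W) := by
    have := entropy_prod_add3 μ ν ρ (fun ω => (m * α + γ) • X ω) (fun _ => (0 : G)) W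
    rw [law_zero ν k1, one_mul] at this
    exact this
  have hP : entropy π P = lawH (law μ (fun ω => α • X ω) * law ν (fun ω => - Z ω)) := by
    have := entropy_prod_add3 μ ν ρ (fun ω => α • X ω) (fun ω => - Z ω) (fun _ => (0 : G))
    rw [law_zero ρ r1, mul_one] at this
    exact this
  have hQ : entropy π Q = lawH (law μ (fun ω => γ • X ω) * (law ν (fun ω => m • Z ω) * law ρ W)) :=
    entropy_prod_add3 μ ν ρ (fun ω => γ • X ω) (fun ω => m • Z ω) W
  have hW : entropy (prodMass ν ρ) (fun v => W v.2) = entropy ρ W := by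
    have := entropy_prod_add ν ρ (fun _ => (0 : G)) W
    rw [law_zero ν k1, one_mul, ← entropy_eq_lawH] at this
    simpa using this
  have hA : entropy π A = entropy μ X + entropy ρ W := by
    rw [← hW]
    exact entropy_prod μ (prodMass ν ρ) h0 (prodMass_nonneg k0 r0) h1 (prodMass_sum k1 r1) X
      (fun v => W v.2)
  have hT : entropy π (fun t => (X t.1, (Z t.2.1, W t.2.2)))
      = entropy μ X + (entropy ν Z + entropy ρ W) := by
    rw [← entropy_prod ν ρ k0 r0 k1 r1]
    exact entropy_prod μ (prodMass ν ρ) h0 (prodMass_nonneg k0 r0) h1 (prodMass_sum k1 r1) X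
      (fun v => (Z v.1, W v.2))
  have sub := entropy_submod π p0 p1 A P C
  have e1 : entropy π (fun t => (A t, P t, C t)) =
      entropy π (fun t => (X t.1, (Z t.2.1, W t.2.2))) := by
    apply entropy_congr_rel
    intro s t
    simp only [A, P, C, Prod.mk.injEq]
    constructor
    · rintro ⟨⟨hx, hw⟩, hp, -⟩
      rw [hx] at hp
      simp at hp
      exact ⟨hx, hp, hw⟩
    · rintro ⟨hx, hz, hw⟩
      simp [hx, hz, hw]
  have e2 : entropy π (fun t => (A t, C t)) = entropy π A := by
    apply entropy_congr_rel
    intro s t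
    simp only [A, C, Prod.mk.injEq]
    constructor
    · rintro ⟨h, -⟩
      exact h
    · rintro ⟨hx, hw⟩
      simp [hx, hw]
  have e3 : entropy π (fun t => (P t, C t)) = entropy π (fun t => (P t, Q t)) := by
    have hCPQ : ∀ t, C t = m • P t + Q t := by
      intro t
      simp only [C, P, Q]
      module
    apply entropy_congr_rel
    intro s t
    simp only [Prod.mk.injEq, hCPQ]
    constructor
    · rintro ⟨h, h'⟩
      rw [h] at h'
      exact ⟨h, by simpa using h'⟩
    · rintro ⟨h, h'⟩
      simp [h, h']
  have e4 := entropy_pair_le π p0 p1 P Q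
  rw [← entropy_eq_lawH ν Z]
  rw [← hC, ← hP, ← hQ]
  linarith

/-- Submodularity for independent sums: `H(A+B+C) + H(B) ≤ H(A+B) + H(B+C)`. -/
lemma add_submod {G : Type*} [AddCommGroup G] {a b c : AddMonoidAlgebra ℝ G}
    (ha : IsLaw a) (hb : IsLaw b) (hc : IsLaw c) :
    lawH (a * (b * c)) + lawH b ≤ lawH (a * b) + lawH (b * c) := by
  obtain ⟨_, μ, X, h0, h1, rfl⟩ := ha
  obtain ⟨_, ν, Y, k0, k1, rfl⟩ := hb
  obtain ⟨_, ρ, Z, r0, r1, rfl⟩ := hc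
  set π := prodMass μ (prodMass ν ρ) with hπ
  have p0 : ∀ ω, 0 ≤ π ω := prodMass_nonneg h0 (prodMass_nonneg k0 r0)
  have p1 : ∑ ω, π ω = 1 := prodMass_sum h1 (prodMass_sum k1 r1)
  have sub := entropy_submod π p0 p1 (fun t => X t.1) (fun t => Z t.2.2)
    (fun t => X t.1 + (Y t.2.1 + Z t.2.2))
  rw [hπ, entropy_prod_add3] at sub
  have e1 : entropy π (fun t => (X t.1, Z t.2.2, X t.1 + (Y t.2.1 + Z t.2.2)))
      = entropy μ X + (entropy ν Y + entropy ρ Z) := by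
    rw [← entropy_prod ν ρ k0 r0 k1 r1]
    rw [← entropy_prod μ (prodMass ν ρ) h0 (prodMass_nonneg k0 r0) h1 (prodMass_sum k1 r1) X
      (fun v => (Y v.1, Z v.2))]
    apply entropy_congr_rel
    intro s t
    simp only [Prod.mk.injEq]
    constructor
    · rintro ⟨h, h', h''⟩
      rw [h, h'] at h''
      exact ⟨h, by simpa using h'', h'⟩
    · rintro ⟨h, h', h''⟩
      simp [h, h', h'']
  have e2 : entropy π (fun t => (X t.1, X t.1 + (Y t.2.1 + Z t.2.2)))
      = entropy μ X + lawH (law ν Y * law ρ Z) := by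
    rw [← entropy_prod_add]
    rw [← entropy_prod μ (prodMass ν ρ) h0 (prodMass_nonneg k0 r0) h1 (prodMass_sum k1 r1) X
      (fun v => Y v.1 + Z v.2)]
    apply entropy_congr_rel
    intro s t
    simp only [Prod.mk.injEq]
    constructor
    · rintro ⟨h, h'⟩
      rw [h] at h'
      exact ⟨h, by simpa using h'⟩
    · rintro ⟨h, h'⟩
      simp [h, h']
  have e3 : entropy π (fun t => (Z t.2.2, X t.1 + (Y t.2.1 + Z t.2.2)))
      ≤ entropy ρ Z + lawH (law μ X * law ν Y) := by
    have hZ := entropy_prod_add3 μ ν ρ (fun _ => (0 : G)) (fun _ => (0 : G)) Z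
    have hXY := entropy_prod_add3 μ ν ρ X Y (fun _ => (0 : G))
    rw [law_zero μ h1, law_zero ν k1, one_mul, one_mul, ← entropy_eq_lawH] at hZ
    rw [law_zero ρ r1, mul_one] at hXY
    rw [← hZ, ← hXY]
    refine le_trans (le_of_eq ?_) (entropy_pair_le _ p0 p1 _ _)
    apply entropy_congr_rel
    intro s t
    simp only [Prod.mk.injEq, zero_add, add_zero, ← add_assoc]
    constructor
    · rintro ⟨h, h'⟩
      rw [h] at h'
      exact ⟨h, by simpa using h'⟩
    · rintro ⟨h, h'⟩
      simp [h, h']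
  rw [← hπ, e1, e2] at sub
  rw [← entropy_eq_lawH ν Y]
  linarith

lemma lawH_neg_mul {Ω Ω' G : Type*} [Fintype Ω] [Fintype Ω'] [AddCommGroup G]
    (μ : Ω → ℝ) (ν : Ω' → ℝ) (X : Ω → G) (Y : Ω' → G) :
    lawH (law μ (fun ω => - X ω) * law ν (fun ω => - Y ω)) = lawH (law μ X * law ν Y) := by
  rw [← entropy_prod_add, ← entropy_prod_add]
  apply entropy_congr_rel
  intro s t
  simp only [← neg_add, neg_inj]

lemma lawH_neg {Ω G : Type*} [Fintype Ω] [AddCommGroup G] (μ : Ω → ℝ) (X : Ω → G) :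
    lawH (law μ (fun ω => - X ω)) = lawH (law μ X) := by
  rw [← entropy_eq_lawH, ← entropy_eq_lawH]
  apply entropy_congr_rel
  intro s t
  simp

/-- The law of `k • X`. -/
noncomputable def sl {Ω G : Type*} [Fintype Ω] [AddCommGroup G] (μ : Ω → ℝ) (X : Ω → G) (k : ℤ) :
    AddMonoidAlgebra ℝ G := law μ (fun ω => k • X ω)

lemma sl_zero {Ω G : Type*} [Fintype Ω] [AddCommGroup G] {μ : Ω → ℝ}
    (h1 : ∑ ω, μ ω = 1) (X : Ω → G) : sl μ X 0 = 1 := by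
  simp [sl, law_zero μ h1]

lemma sl_isLaw {Ω G : Type*} [Fintype Ω] [AddCommGroup G] {μ : Ω → ℝ} (h0 : ∀ ω, 0 ≤ μ ω)
    (h1 : ∑ ω, μ ω = 1) (X : Ω → G) (k : ℤ) : IsLaw (sl μ X k) := isLaw_law h0 h1 _

lemma sl_neg {Ω G : Type*} [Fintype Ω] [AddCommGroup G] (μ : Ω → ℝ) (X : Ω → G) (k : ℤ) :
    lawH (sl μ X (-k)) = lawH (sl μ X k) := by
  simp only [sl, neg_smul]
  exact lawH_neg _ _

lemma sl_neg_mul {Ω Ω' G : Type*} [Fintype Ω] [Fintype Ω'] [AddCommGroup G]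
    (μ : Ω → ℝ) (ν : Ω' → ℝ) (X : Ω → G) (Y : Ω' → G) (k l : ℤ) :
    lawH (sl μ X (-k) * sl ν Y (-l)) = lawH (sl μ X k * sl ν Y l) := by
  simp only [sl, neg_smul]
  exact lawH_neg_mul _ _ _ _

lemma sl_key {Ω Ω' G : Type*} [Fintype Ω] [Fintype Ω'] [AddCommGroup G]
    {μ : Ω → ℝ} (h0 : ∀ ω, 0 ≤ μ ω) (h1 : ∑ ω, μ ω = 1)
    {ν : Ω' → ℝ} (k0 : ∀ ω, 0 ≤ ν ω) (k1 : ∑ ω, ν ω = 1)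
    (X : Ω → G) (Z : Ω' → G) {w : AddMonoidAlgebra ℝ G} (hw : IsLaw w) (m α γ j : ℤ) :
    lawH (sl μ X (m * α + γ) * w) + lawH (sl ν Z j)
      ≤ lawH (sl μ X α * sl ν Z (-j)) + lawH (sl μ X γ * (sl ν Z (m * j) * w)) := by
  have := key_ineq h0 h1 k0 k1 X (fun ω => j • Z ω) hw m α γ
  simpa only [sl, neg_smul, mul_smul] using this

lemma lawH_mono {G : Type*} [AddCommGroup G] {a b : AddMonoidAlgebra ℝ G}
    (ha : IsLaw a) (hb : IsLaw b) : lawH b ≤ lawH (a * b) := by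
  obtain ⟨_, μ, X, h0, h1, rfl⟩ := ha
  obtain ⟨_, ν, Y, k0, k1, rfl⟩ := hb
  have := sl_key h0 h1 k0 k1 X Y isLaw_one 0 1 0 (-1)
  simp only [zero_mul, zero_add, sl_zero h1, sl_zero k1, neg_neg, mul_one, sl_neg] at this
  simp only [sl, one_smul] at this
  linarith

/-- Adding an independent `L` to a sum with a summand `±Y` increases entropy by at most `c`. -/
def Cheap {Ω G : Type*} [Fintype Ω] [AddCommGroup G] (ν : Ω → ℝ) (Y : Ω → G) (c : ℝ)
    (L : AddMonoidAlgebra ℝ G) : Prop :=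
  ∀ (V : AddMonoidAlgebra ℝ G) (t : ℤ), IsLaw V → (t = 1 ∨ t = -1) →
    lawH (L * (sl ν Y t * V)) ≤ lawH (sl ν Y t * V) + c

lemma lawH_double {G : Type*} [AddCommGroup G] {a b : AddMonoidAlgebra ℝ G}
    (ha : IsLaw a) (hb : IsLaw b) : lawH (b * b) + lawH a ≤ 2 * lawH (a * b) := by
  have h1 := lawH_mono ha (hb.mul hb)
  have h2 := add_submod hb ha hb
  rw [show b * (a * b) = a * (b * b) by ring, mul_comm b a] at h2
  linarith

lemma sign_bound {Ω Ω' G : Type*} [Fintype Ω] [Fintype Ω'] [AddCommGroup G]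
    {μ : Ω → ℝ} (h0 : ∀ ω, 0 ≤ μ ω) (h1 : ∑ ω, μ ω = 1)
    {ν : Ω' → ℝ} (k0 : ∀ ω, 0 ≤ ν ω) (k1 : ∑ ω, ν ω = 1)
    (X : Ω → G) (Y : Ω' → G) (d : ℝ)
    (hd : d = 2 * lawH (sl μ X 1 * sl ν Y 1) - lawH (sl μ X 1) - lawH (sl ν Y 1))
    (s t : ℤ) (hs : s = 1 ∨ s = -1) (ht : t = 1 ∨ t = -1) :
    lawH (sl μ X s * sl ν Y t) ≤ lawH (sl μ X 1 * sl ν Y 1) + d := by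
  have hx := sl_isLaw h0 h1 X
  have hy := sl_isLaw k0 k1 Y
  have m1 := lawH_mono (hx 1) (hy 1)
  have m2 := lawH_mono (hy 1) (hx 1)
  rw [mul_comm] at m2
  have dbl := lawH_double (hx 1) (hy 1)
  have T := sl_key h0 h1 k0 k1 X Y (hy (-1)) 1 1 0 (-1)
  simp only [one_mul, add_zero, sl_zero h1, neg_neg, sl_neg, sl_neg_mul] at T
  have T' := sl_neg_mul μ ν X Y 1 (-1)
  rw [neg_neg] at T'
  have T'' := sl_neg_mul μ ν X Y 1 1
  rcases hs with rfl | rfl <;> rcases ht with rfl | rfl <;> linarith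

lemma two_bound {Ω Ω' G : Type*} [Fintype Ω] [Fintype Ω'] [AddCommGroup G]
    {μ : Ω → ℝ} (h0 : ∀ ω, 0 ≤ μ ω) (h1 : ∑ ω, μ ω = 1)
    {ν : Ω' → ℝ} (k0 : ∀ ω, 0 ≤ ν ω) (k1 : ∑ ω, ν ω = 1)
    (X : Ω → G) (Y : Ω' → G) (d : ℝ)
    (hd : d = 2 * lawH (sl μ X 1 * sl ν Y 1) - lawH (sl μ X 1) - lawH (sl ν Y 1)) :
    lawH (sl μ X 2 * sl μ X (-1)) ≤ lawH (sl μ X 1) + 2 * d := by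
  have hx := sl_isLaw h0 h1 X
  have hy := sl_isLaw k0 k1 Y
  have m1 := lawH_mono (hx 1) (hy 1)
  have m2 := lawH_mono (hy 1) (hx 1)
  rw [mul_comm] at m2
  have a1 := sl_key h0 h1 k0 k1 X Y (hx (-1)) 1 1 1 (-1)
  have a2 := add_submod (hx 1) (hx (-1)) (hy (-1))
  have a3 := sl_key h0 h1 k0 k1 X Y (hx (-1)) 1 1 0 (-1)
  rw [mul_comm (sl ν Y _) (sl μ X (-1))] at a1 a3
  norm_num at a1 a3
  simp only [sl_zero h1, sl_neg, sl_neg_mul, one_mul] at a1 a2 a3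
  linarith

lemma halving {Ω Ω' G : Type*} [Fintype Ω] [Fintype Ω'] [AddCommGroup G]
    {μ : Ω → ℝ} (h0 : ∀ ω, 0 ≤ μ ω) (h1 : ∑ ω, μ ω = 1)
    {ν : Ω' → ℝ} (k0 : ∀ ω, 0 ≤ ν ω) (k1 : ∑ ω, ν ω = 1)
    (X : Ω → G) (Y : Ω' → G) (d : ℝ)
    (hd : d = 2 * lawH (sl μ X 1 * sl ν Y 1) - lawH (sl μ X 1) - lawH (sl ν Y 1))
    (n : ℕ) : ∀ p : ℤ, p.natAbs = n → 1 ≤ n → ∀ w, IsLaw w →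
    ∃ (s : ℤ) (L : AddMonoidAlgebra ℝ G), (s = 1 ∨ s = -1) ∧ IsLaw L ∧
      Cheap ν Y (2 * d * Nat.log 2 n) L ∧
      lawH (sl μ X p * w) ≤ lawH (sl μ X s * (L * w)) + 2 * d * Nat.log 2 n := by
  have hx := sl_isLaw h0 h1 X
  have hy := sl_isLaw k0 k1 Y
  have m1 := lawH_mono (hx 1) (hy 1)
  have m2 := lawH_mono (hy 1) (hx 1)
  rw [mul_comm] at m2
  have tb := two_bound h0 h1 k0 k1 X Y d hd
  have sb := sign_bound h0 h1 k0 k1 X Y d hd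
  induction n using Nat.strong_induction_on with
  | _ n ih =>
  intro p hp hn w hw
  rcases hn.eq_or_lt with h | h
  · refine ⟨p, 1, by omega, isLaw_one, ?_, ?_⟩
    · intro V t _ _
      simp [← h]
    · simp [← h]
  obtain ⟨r, ε, hpe, hr, hε⟩ : ∃ r ε : ℤ, p = r * 2 + ε ∧ r.natAbs = n / 2 ∧
      (ε = 0 ∨ ε = 1 ∨ ε = -1) := by
    rcases le_total 0 p with h | h
    · exact ⟨p / 2, p % 2, by omega, by omega, by omega⟩
    · exact ⟨-((-p) / 2), -((-p) % 2), by omega, by omega, by omega⟩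
  obtain ⟨s, L, hs, hL, hc, hle⟩ := ih (n / 2) (by omega) r hr (by omega) (sl μ X ε * w)
    ((hx ε).mul hw)
  have hlog : (Nat.log 2 n : ℝ) = Nat.log 2 (n / 2) + 1 := by
    have := Nat.log_of_one_lt_of_le (b := 2) (by norm_num) (show 2 ≤ n by omega)
    rw [this]
    push_cast
    ring
  refine ⟨s, L * sl μ X ε, hs, hL.mul (hx ε), ?_, ?_⟩
  · intro V t hV ht
    have c1 := hc (sl μ X ε * V) t ((hx ε).mul hV) ht
    rw [show L * (sl ν Y t * (sl μ X ε * V)) = L * sl μ X ε * (sl ν Y t * V) by ring] at c1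
    have c2 : lawH (sl ν Y t * (sl μ X ε * V)) ≤ lawH (sl ν Y t * V) + 2 * d := by
      rcases hε with rfl | hε
      · rw [sl_zero h1, one_mul]
        linarith
      · have c3 := add_submod (hx ε) (hy t) hV
        have c4 := sb ε t hε ht
        have c5 : lawH (sl ν Y t) = lawH (sl ν Y 1) := by
          rcases ht with rfl | rfl
          · rfl
          · exact sl_neg _ _ _
        rw [show sl ν Y t * (sl μ X ε * V) = sl μ X ε * (sl ν Y t * V) by ring]
        linarith
    rw [hlog]
    linarith
  · have a1 := sl_key h0 h1 h0 h1 X X hw r 2 ε 1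
    rw [mul_one, ← hpe,
      show sl μ X ε * (sl μ X r * w) = sl μ X r * (sl μ X ε * w) by ring] at a1
    rw [hlog, show sl μ X s * (L * sl μ X ε * w) = sl μ X s * (L * (sl μ X ε * w)) by ring]
    linarith

lemma law_indep {Ω G : Type*} [Fintype Ω] [AddCommGroup G]
    (μ : Ω → ℝ) (X Y : Ω → G)
    (hindep : ∀ a b : G, pr μ (fun ω => (X ω, Y ω)) (a, b) = pr μ X a * pr μ Y b)
    (p q : ℤ) : law μ (fun ω => p • X ω + q • Y ω) = sl μ X p * sl μ Y q := by
  rw [sl, sl, ← law_prod]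
  ext g
  rw [law_coeff, law_coeff]
  let F : G × G → ℝ := fun t => if p • t.1 + q • t.2 = g then 1 else 0
  have e1 := sum_group μ (fun ω => (X ω, Y ω)) F (Finset.univ.image X ×ˢ Finset.univ.image Y)
    (by simp)
  have e2 := sum_group (prodMass μ μ) (fun ω => (X ω.1, Y ω.2)) F
    (Finset.univ.image X ×ˢ Finset.univ.image Y) (by simp)
  have e3 : ∀ t : G × G, pr μ (fun ω => (X ω, Y ω)) t =
      pr (prodMass μ μ) (fun ω => (X ω.1, Y ω.2)) t := by
    rintro ⟨a, b⟩
    rw [hindep, pr_prod]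
  simp only [e3] at e1
  rw [← e2] at e1
  simpa [F, pr] using e1

lemma floor_log_eq (p : ℤ) : ⌊Real.logb 2 |(p : ℝ)|⌋ = (Nat.log 2 p.natAbs : ℤ) := by
  have h : |(p : ℝ)| = (p.natAbs : ℝ) := by
    rw [Nat.cast_natAbs, Int.cast_abs]
  have := Real.floor_logb_natCast (b := 2) (r := (p.natAbs : ℝ)) (Nat.cast_nonneg _)
  rw [h]
  rw [Int.log_natCast] at this
  exact_mod_cast this

/-- Wu–Shamai–Verdú, Theorem 14: for independent `G`-valued random variables and
nonzero integers `p, q`,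
`H(pX + qY) − H(X + Y) ≤ (7⌊log₂|p|⌋ + 7⌊log₂|q|⌋ + 2)(2H(X+Y) − H(X) − H(Y))`. -/
theorem entropy_int_combination {Ω G : Type*} [Fintype Ω] [AddCommGroup G]
    (μ : Ω → ℝ) (hμ0 : ∀ ω, 0 ≤ μ ω) (hμ1 : ∑ ω, μ ω = 1)
    (X Y : Ω → G)
    (hindep : ∀ a b : G, pr μ (fun ω => (X ω, Y ω)) (a, b) = pr μ X a * pr μ Y b)
    (p q : ℤ) (hp : 1 ≤ |p|) (hq : 1 ≤ |q|) :
    entropy μ (fun ω => p • X ω + q • Y ω) - entropy μ (fun ω => X ω + Y ω)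
      ≤ ((7 * ⌊Real.logb 2 |(p : ℝ)|⌋ + 7 * ⌊Real.logb 2 |(q : ℝ)|⌋ + 2 : ℤ) : ℝ) *
        (2 * entropy μ (fun ω => X ω + Y ω) - entropy μ X - entropy μ Y) := by
  rw [entropy_eq_lawH, law_indep μ X Y hindep]
  have hS : entropy μ (fun ω => X ω + Y ω) = lawH (sl μ X 1 * sl μ Y 1) := by
    rw [← law_indep μ X Y hindep 1 1, ← entropy_eq_lawH]
    simp
  have hX : entropy μ X = lawH (sl μ X 1) := by
    rw [entropy_eq_lawH]
    simp [sl]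
  have hY : entropy μ Y = lawH (sl μ Y 1) := by
    rw [entropy_eq_lawH]
    simp [sl]
  rw [hS, hX, hY, floor_log_eq, floor_log_eq]
  obtain ⟨d, hd⟩ : ∃ d, d = 2 * lawH (sl μ X 1 * sl μ Y 1) - lawH (sl μ X 1) - lawH (sl μ Y 1) :=
    ⟨_, rfl⟩
  have hd' : d = 2 * lawH (sl μ Y 1 * sl μ X 1) - lawH (sl μ Y 1) - lawH (sl μ X 1) := by
    rw [hd, mul_comm (sl μ Y 1)]
    ring
  have hx := sl_isLaw hμ0 hμ1 X
  have hy := sl_isLaw hμ0 hμ1 Y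
  have m1 := lawH_mono (hx 1) (hy 1)
  have m2 := lawH_mono (hy 1) (hx 1)
  rw [mul_comm] at m2
  have hd0 : 0 ≤ d := by linarith
  obtain ⟨s, L, hs, hL, hLc, hLe⟩ := halving hμ0 hμ1 hμ0 hμ1 X Y d hd p.natAbs p rfl (by rw [Int.abs_eq_natAbs] at hp hq; omega)
    (sl μ Y q) (hy q)
  obtain ⟨t, M, ht, hM, hMc, hMe⟩ := halving hμ0 hμ1 hμ0 hμ1 Y X d hd' q.natAbs q rfl (by rw [Int.abs_eq_natAbs] at hp hq; omega)
    (sl μ X s * L) ((hx s).mul hL)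
  have c1 := hLc (sl μ X s * M) t ((hx s).mul hM) ht
  have c2 := hMc (sl μ Y t) s (hy t) hs
  have c3 := sign_bound hμ0 hμ1 hμ0 hμ1 X Y d hd s t hs ht
  rw [show sl μ Y q * (sl μ X s * L) = sl μ X s * (L * sl μ Y q) by ring,
    show sl μ Y t * (M * (sl μ X s * L)) = L * (sl μ Y t * (sl μ X s * M)) by ring] at hMe
  rw [show sl μ Y t * (sl μ X s * M) = M * (sl μ X s * sl μ Y t) by ring] at c1 hMe
  rw [← hd]
  push_cast
  have n1 : 0 ≤ d * (Nat.log 2 p.natAbs : ℝ) := by positivity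
  have n2 : 0 ≤ d * (Nat.log 2 q.natAbs : ℝ) := by positivity
  linarith
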